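/- Let G be a spray on a nonempty open set U ⊆ ℝ^n with n ≥ 3. Then the following are equivalent: (a) G is BWeyl-flat, i.e. there exists a volume form dV on U such that the Berwald–Weyl curvature of (G,dV) vanishes identically; (b) for every volume form dV on U there is a smooth function f on U such that W^o_k = W^m_k f_{x^m}; (c) for every volume form dV on U there is a smooth function f on U such that W^m_{k|m} = (n−2) W^m_k Ξ_{·m}, where Ξ := S/(n+1) + f₀ with f₀ := f_{x^m} y^m, S is the S-curvature of (G,dV), and '|' is the horizontal covariant derivative with respect to G. -/

import Mathlib

open scoped BigOperators
open MeasureTheory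

noncomputable section BerwaldWeyl

/-- Points/vectors in local coordinates on `ℝⁿ`. -/
abbrev Vec (n : ℕ) := Fin n → ℝ

/-- Partial derivative in the base (`x`) variable along the `i`-th coordinate. -/
def pdx {n : ℕ} (f : Vec n → Vec n → ℝ) (i : Fin n) : Vec n → Vec n → ℝ :=
  fun x y => fderiv ℝ (fun x' => f x' y) x (Pi.single i 1)

/-- Vertical derivative `f_{·i} = ∂f/∂y^i`. -/
def pdy {n : ℕ} (f : Vec n → Vec n → ℝ) (i : Fin n) : Vec n → Vec n → ℝ :=
  fun x y => fderiv ℝ (fun y' => f x y') y (Pi.single i 1)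

/-- The slit fiber `ℝⁿ \ {0}`. -/
def slit (n : ℕ) : Set (Vec n) := {y | y ≠ 0}

/-- A spray on `U ⊆ ℝⁿ`: a family `G^i(x,y)`, smooth on `U × (ℝⁿ \ {0})` and
positively 2-homogeneous in `y`. -/
def IsSpray {n : ℕ} (U : Set (Vec n)) (G : Fin n → Vec n → Vec n → ℝ) : Prop :=
  (∀ i, ContDiffOn ℝ (⊤ : ℕ∞) (fun p : Vec n × Vec n => G i p.1 p.2) (U ×ˢ slit n)) ∧
  (∀ i, ∀ x ∈ U, ∀ y ∈ slit n, ∀ c : ℝ, 0 < c → G i x (c • y) = c ^ 2 * G i x y)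

/-- Nonlinear connection coefficients `N^i_j := ∂G^i/∂y^j`. -/
def Nc {n : ℕ} (G : Fin n → Vec n → Vec n → ℝ) (i j : Fin n) : Vec n → Vec n → ℝ :=
  pdy (G i) j

/-- Berwald connection coefficients `Γ^i_{jk} := ∂²G^i/∂y^j∂y^k`. -/
def Γc {n : ℕ} (G : Fin n → Vec n → Vec n → ℝ) (i j k : Fin n) : Vec n → Vec n → ℝ :=
  pdy (pdy (G i) j) k

/-- Horizontal derivative of a scalar: `f_{|k} := δf/δx^k = ∂f/∂x^k - N^l_k ∂f/∂y^l`. -/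
def hD {n : ℕ} (G : Fin n → Vec n → Vec n → ℝ) (f : Vec n → Vec n → ℝ) (k : Fin n) :
    Vec n → Vec n → ℝ :=
  fun x y => pdx f k x y - ∑ l, Nc G l k x y * pdy f l x y

/-- Horizontal covariant derivative `A_{j|m}` of a 1-form `A_j`. -/
def covD1 {n : ℕ} (G : Fin n → Vec n → Vec n → ℝ) (A : Fin n → Vec n → Vec n → ℝ)
    (j m : Fin n) : Vec n → Vec n → ℝ :=
  fun x y => hD G (A j) m x y - ∑ l, A l x y * Γc G l j m x y

/-- Horizontal covariant derivative `A^i_{j|m}` of a (1,1)-tensor `A^i_j`. -/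
def covD11 {n : ℕ} (G : Fin n → Vec n → Vec n → ℝ)
    (A : Fin n → Fin n → Vec n → Vec n → ℝ) (i j m : Fin n) : Vec n → Vec n → ℝ :=
  fun x y => hD G (A i j) m x y + ∑ l, A l j x y * Γc G i l m x y
    - ∑ l, A i l x y * Γc G l j m x y

/-- Horizontal covariant derivative `B^i_{jk|m}` of a (1,2)-tensor `B^i_{jk}`. -/
def covD12 {n : ℕ} (G : Fin n → Vec n → Vec n → ℝ)
    (B : Fin n → Fin n → Fin n → Vec n → Vec n → ℝ) (i j k m : Fin n) : Vec n → Vec n → ℝ :=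
  fun x y => hD G (B i j k) m x y + ∑ l, B l j k x y * Γc G i l m x y
    - ∑ l, B i l k x y * Γc G l j m x y - ∑ l, B i j l x y * Γc G l k m x y

/-- Riemann curvature `R^i_k`. -/
def Riem {n : ℕ} (G : Fin n → Vec n → Vec n → ℝ) (i k : Fin n) : Vec n → Vec n → ℝ :=
  fun x y => 2 * pdx (G i) k x y - ∑ j, y j * pdy (pdx (G i) j) k x y
    + 2 * ∑ j, G j x y * Γc G i j k x y - ∑ s, Nc G i s x y * Nc G s k x y

/-- Ricci scalar `R := R^m_m/(n-1)`. -/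
def Ricci {n : ℕ} (G : Fin n → Vec n → Vec n → ℝ) : Vec n → Vec n → ℝ :=
  fun x y => (∑ m, Riem G m m x y) / ((n : ℝ) - 1)

/-- The Weyl-type curvature `T^i_k := R^i_k - (R δ^i_k - ½ R_{·k} y^i)`. -/
def Tcurv {n : ℕ} (G : Fin n → Vec n → Vec n → ℝ) (i k : Fin n) : Vec n → Vec n → ℝ :=
  fun x y => Riem G i k x y -
    (Ricci G x y * (if i = k then 1 else 0) - (1/2) * pdy (Ricci G) k x y * y i)

/-- The χ-curvature `χ_i := -(1/3) T^m_{i·m}`. -/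
def chiC {n : ℕ} (G : Fin n → Vec n → Vec n → ℝ) (i : Fin n) : Vec n → Vec n → ℝ :=
  fun x y => -(1/3) * ∑ m, pdy (Tcurv G m i) m x y

/-- The Weyl curvature `W^i_k := T^i_k + (3χ_k/(n+1)) y^i`. -/
def Weyl {n : ℕ} (G : Fin n → Vec n → Vec n → ℝ) (i k : Fin n) : Vec n → Vec n → ℝ :=
  fun x y => Tcurv G i k x y + (3 * chiC G k x y / ((n : ℝ) + 1)) * y i

/-- A volume form `dV = σ(x) dx` on `U`: `σ` smooth and positive. -/
def IsVolumeForm {n : ℕ} (U : Set (Vec n)) (σ : Vec n → ℝ) : Prop :=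
  ContDiffOn ℝ (⊤ : ℕ∞) σ U ∧ ∀ x ∈ U, 0 < σ x

/-- The S-curvature of `(G, dV)`: `S := ∂G^m/∂y^m - y^m ∂(ln σ)/∂x^m`. -/
def Scurv {n : ℕ} (G : Fin n → Vec n → Vec n → ℝ) (σ : Vec n → ℝ) : Vec n → Vec n → ℝ :=
  fun x y => ∑ m, Nc G m m x y
    - ∑ m, y m * fderiv ℝ (fun x' => Real.log (σ x')) x (Pi.single m 1)

/-- The projective spray `Ĝ^i := G^i - (S/(n+1)) y^i` of `(G, dV)`. -/
def Ghat {n : ℕ} (G : Fin n → Vec n → Vec n → ℝ) (σ : Vec n → ℝ) :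
    Fin n → Vec n → Vec n → ℝ :=
  fun i x y => G i x y - (Scurv G σ x y / ((n : ℝ) + 1)) * y i

/-- The Berwald–Weyl curvature `W^o_k := R̂_{∥k} - ½ R̂_{·k∥m} y^m` of `(G, dV)`,
where all hatted quantities and `∥` are taken with respect to the projective spray `Ĝ`. -/
def BWeyl {n : ℕ} (G : Fin n → Vec n → Vec n → ℝ) (σ : Vec n → ℝ) (k : Fin n) :
    Vec n → Vec n → ℝ :=
  fun x y => hD (Ghat G σ) (Ricci (Ghat G σ)) k x y
    - (1/2) * ∑ m, covD1 (Ghat G σ) (fun j => pdy (Ricci (Ghat G σ)) j) k m x y * y m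

/-- An algebra of functions of `2n` variables `(x, y)`: commuting coordinate derivations
`∂/∂xⁱ`, `∂/∂yⁱ` together with the fibre coordinates `yⁱ`. -/
structure CoordAlg (n : ℕ) (A : Type*) [CommRing A] [Algebra ℝ A] where
  X : Fin n → Derivation ℝ A A
  Y : Fin n → Derivation ℝ A A
  y : Fin n → A
  X_X : ∀ i j f, X i (X j f) = X j (X i f)
  X_Y : ∀ i j f, X i (Y j f) = Y j (X i f)
  Y_Y : ∀ i j f, Y i (Y j f) = Y j (Y i f)
  X_y : ∀ i j, X i (y j) = 0
  Y_y : ∀ i j, Y i (y j) = if i = j then 1 else 0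

namespace CoordAlg

open Finset

variable {n : ℕ} {A : Type*} [CommRing A] [Algebra ℝ A] (S : CoordAlg n A) (g : Fin n → A)

theorem _root_.Derivation.sum_smul_apply {ι : Type*} (s : Finset ι) (a : ι → A)
    (D : ι → Derivation ℝ A A) (f : A) :
    (∑ i ∈ s, a i • D i) f = ∑ i ∈ s, a i * D i f := by
  classical
  induction s using Finset.induction_on with
  | empty => simp
  | insert i s hi ih => simp [sum_insert hi, ih]

theorem _root_.Derivation.map_two (D : Derivation ℝ A A) : D 2 = 0 :=
  mod_cast D.map_natCast 2

/-- The nonlinear connection coefficients. -/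
def conn (i j : Fin n) : A := S.Y j (g i)

/-- The Berwald connection coefficients. -/
def berw (i j k : Fin n) : A := S.Y k (S.Y j (g i))

/-- The horizontal derivation `δ/δxᵏ`. -/
def δ (k : Fin n) : Derivation ℝ A A := S.X k - ∑ l, S.conn g l k • S.Y l

/-- The Euler (Liouville) derivation. -/
def euler : Derivation ℝ A A := ∑ j, S.y j • S.Y j

/-- The spray vector field. -/
def sprayField : Derivation ℝ A A := ∑ j, S.y j • S.δ g j

/-- The curvature of the nonlinear connection. -/
def curv (i j k : Fin n) : A := S.δ g k (S.conn g i j) - S.δ g j (S.conn g i k)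

/-- The Riemann curvature. -/
def riem (i k : Fin n) : A :=
  2 * S.X k (g i) - ∑ j, S.y j * S.Y k (S.X j (g i))
    + 2 * ∑ j, g j * S.berw g i j k - ∑ s, S.conn g i s * S.conn g s k

/-- Homogeneity of degree two in the fibre variable. -/
def IsHom : Prop := ∀ i, S.euler (g i) = 2 * g i

theorem δ_apply (k : Fin n) (f : A) :
    S.δ g k f = S.X k f - ∑ l, S.conn g l k * S.Y l f := by
  simp [δ, Derivation.sum_smul_apply]

theorem euler_apply (f : A) : S.euler f = ∑ j, S.y j * S.Y j f :=
  Derivation.sum_smul_apply ..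

theorem sprayField_apply (f : A) : S.sprayField g f = ∑ j, S.y j * S.δ g j f :=
  Derivation.sum_smul_apply ..

theorem berw_comm (i j k : Fin n) : S.berw g i j k = S.berw g i k j := S.Y_Y ..

theorem Y_conn (i j k : Fin n) : S.Y k (S.conn g i j) = S.berw g i j k := rfl

theorem Y_δ (j k : Fin n) (f : A) :
    S.Y j (S.δ g k f) = S.δ g k (S.Y j f) - ∑ l, S.berw g l k j * S.Y l f := by
  simp only [δ_apply, map_sub, map_sum, Derivation.leibniz, smul_eq_mul, Y_conn, sum_add_distrib,
    S.X_Y, S.Y_Y j, mul_comm]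
  ring

theorem δ_δ (j k : Fin n) (f : A) :
    S.δ g j (S.δ g k f) - S.δ g k (S.δ g j f) = ∑ l, S.curv g l j k * S.Y l f := by
  have key : ∀ j k, S.δ g j (S.δ g k f) = S.X j (S.X k f)
      - ∑ l, (S.conn g l j * S.Y l (S.X k f) + S.conn g l k * S.Y l (S.X j f))
      + ∑ l, ∑ m, S.conn g l k * S.conn g m j * S.Y m (S.Y l f)
      - ∑ l, S.δ g j (S.conn g l k) * S.Y l f := fun j k ↦ by
    rw [S.δ_apply g k, map_sub, map_sum, S.δ_apply g j (S.X k f)]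
    simp only [Derivation.leibniz, smul_eq_mul, sum_add_distrib, S.δ_apply g j (S.Y _ f), mul_sub,
      sum_sub_distrib, mul_sum, S.X_Y, mul_assoc, mul_comm (S.Y _ f)]
    ring
  have sym : ∑ l, ∑ m, S.conn g l k * S.conn g m j * S.Y m (S.Y l f)
      = ∑ l, ∑ m, S.conn g l j * S.conn g m k * S.Y m (S.Y l f) := by
    rw [sum_comm]
    refine sum_congr rfl fun l _ ↦ sum_congr rfl fun m _ ↦ ?_
    rw [S.Y_Y]; ring
  rw [key, key, sym, S.X_X j k]
  simp only [curv, sub_mul, sum_sub_distrib, sum_add_distrib]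
  ring

theorem δ_y (k i : Fin n) : S.δ g k (S.y i) = - S.conn g i k := by
  simp [δ_apply, S.X_y, S.Y_y]

theorem euler_y (i : Fin n) : S.euler (S.y i) = S.y i := by
  simp [euler_apply, S.Y_y]

theorem Y_euler (k : Fin n) (f : A) : S.Y k (S.euler f) = S.euler (S.Y k f) + S.Y k f := by
  simp [euler_apply, S.Y_y, S.Y_Y k, sum_add_distrib]

theorem X_euler (k : Fin n) (f : A) : S.X k (S.euler f) = S.euler (S.X k f) := by
  simp [euler_apply, S.X_y, S.X_Y]

variable {S g}

theorem IsHom.euler_conn (hg : S.IsHom g) (i j : Fin n) :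
    S.euler (S.conn g i j) = S.conn g i j := by
  have := S.Y_euler j (g i)
  rw [hg i] at this
  simp [Derivation.map_two] at this
  change S.euler (S.Y j (g i)) = S.Y j (g i)
  linear_combination (-1 : A) * this

theorem IsHom.euler_δ (hg : S.IsHom g) (k : Fin n) (f : A) :
    S.euler (S.δ g k f) = S.δ g k (S.euler f) := by
  have h : ∀ l, S.euler (S.Y l f) = S.Y l (S.euler f) - S.Y l f := fun l ↦ by
    rw [Y_euler]; ring
  simp only [δ_apply, map_sub, map_sum, Derivation.leibniz, smul_eq_mul, hg.euler_conn, h,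
    ← X_euler, mul_sub, sum_add_distrib, sum_sub_distrib, mul_comm (S.Y _ f)]
  ring

theorem IsHom.sum_y_conn (hg : S.IsHom g) (i : Fin n) :
    ∑ j, S.y j * S.conn g i j = 2 * g i := by
  rw [← hg i, euler_apply]; rfl

theorem IsHom.sum_y_berw (hg : S.IsHom g) (i k : Fin n) :
    ∑ j, S.y j * S.berw g i j k = S.conn g i k := by
  rw [← hg.euler_conn i k, euler_apply]
  simp only [Y_conn, S.berw_comm g i k]

theorem IsHom.sum_y_berw' (hg : S.IsHom g) (i k : Fin n) :
    ∑ j, S.y j * S.berw g i k j = S.conn g i k := by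
  simp only [S.berw_comm g i k, hg.sum_y_berw]

theorem IsHom.euler_curv (hg : S.IsHom g) (i j k : Fin n) :
    S.euler (S.curv g i j k) = S.curv g i j k := by
  simp only [curv, map_sub, hg.euler_δ, hg.euler_conn]

theorem curv_antisymm (i j k : Fin n) : S.curv g i j k = - S.curv g i k j := by
  simp [curv]

theorem IsHom.sprayField_apply' (hg : S.IsHom g) (f : A) :
    S.sprayField g f = ∑ j, S.y j * S.X j f - 2 * ∑ j, g j * S.Y j f := by
  simp only [sprayField_apply, δ_apply, mul_sub, sum_sub_distrib, mul_sum]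
  rw [sum_comm]
  simp only [← mul_assoc, ← sum_mul, hg.sum_y_conn]

theorem IsHom.riem_eq (hg : S.IsHom g) (i k : Fin n) :
    S.riem g i k = ∑ j, S.y j * S.curv g i j k := by
  have h1 : ∑ j, S.y j * S.δ g k (S.conn g i j)
      = 2 * S.δ g k (g i) + ∑ j, S.conn g i j * S.conn g j k := by
    have := congrArg (S.δ g k) (hg.sum_y_conn i)
    simp [S.δ_y, sum_add_distrib, Derivation.map_two] at this
    linear_combination this
  have h2 := hg.sprayField_apply' (S.conn g i k)
  rw [sprayField_apply] at h2
  simp only [curv, mul_sub, sum_sub_distrib, h1, h2, riem, S.δ_apply g k (g i), Y_conn]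
  simp only [conn, S.X_Y, S.berw_comm g i k, mul_comm (S.Y k (g _))]
  ring

theorem IsHom.riem_contract (hg : S.IsHom g) (h2 : IsUnit (2 : A)) (i : Fin n) :
    ∑ k, S.riem g i k * S.y k = 0 := by
  have h : ∑ k, S.riem g i k * S.y k = - ∑ k, S.riem g i k * S.y k := by
    simp only [hg.riem_eq, sum_mul]
    conv_lhs => rw [sum_comm]
    rw [← sum_neg_distrib]
    refine sum_congr rfl fun l _ ↦ ?_
    rw [← sum_neg_distrib]
    refine sum_congr rfl fun m _ ↦ ?_
    rw [S.curv_antisymm]; ring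
  refine h2.mul_left_cancel ?_
  linear_combination h

theorem IsHom.euler_riem (hg : S.IsHom g) (i k : Fin n) :
    S.euler (S.riem g i k) = 2 * S.riem g i k := by
  simp only [hg.riem_eq, map_sum, Derivation.leibniz, smul_eq_mul, hg.euler_curv, euler_y,
    mul_sum, mul_comm (S.curv g _ _ _), ← two_mul]

theorem vertical_bianchi (i j k l : Fin n) :
    S.Y l (S.curv g i j k) + S.Y j (S.curv g i k l) + S.Y k (S.curv g i l j) = 0 := by
  simp only [curv, map_sub, Y_δ, Y_conn]
  rw [S.berw_comm g i j l, S.berw_comm g i k l, S.berw_comm g i j k]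
  simp only [S.berw_comm g _ k l, S.berw_comm g _ l j, S.berw_comm g _ k j]
  ring

theorem IsHom.three_curv (hg : S.IsHom g) (i l k : Fin n) :
    3 * S.curv g i l k = S.Y l (S.riem g i k) - S.Y k (S.riem g i l) := by
  have h : ∀ l k, S.Y l (S.riem g i k) = S.curv g i l k + ∑ j, S.y j * S.Y l (S.curv g i j k) :=
    fun l k ↦ by
      simp [hg.riem_eq, S.Y_y, sum_add_distrib, add_comm]
  have hb : ∑ j, S.y j * S.Y l (S.curv g i j k) - ∑ j, S.y j * S.Y k (S.curv g i j l)
      = S.curv g i l k := by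
    rw [← hg.euler_curv i l k, euler_apply, ← sum_sub_distrib]
    refine sum_congr rfl fun j _ ↦ ?_
    have := S.vertical_bianchi (g := g) i j k l
    rw [S.curv_antisymm i k l, S.curv_antisymm i l j] at this
    simp only [map_neg] at this
    linear_combination S.y j * this
  rw [h l k, h k l, S.curv_antisymm i k l]
  linear_combination -hb

theorem horizontal_bianchi (i j k l : Fin n) :
    (S.δ g l (S.curv g i j k) + ∑ s, S.curv g s j k * S.berw g i s l)
      + (S.δ g j (S.curv g i k l) + ∑ s, S.curv g s k l * S.berw g i s j)
      + (S.δ g k (S.curv g i l j) + ∑ s, S.curv g s l j * S.berw g i s k) = 0 := by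
  have h := fun a b c ↦ S.δ_δ g a b (S.conn g i c)
  simp only [Y_conn] at h
  simp only [S.berw_comm g i _ l, S.berw_comm g i _ j, S.berw_comm g i _ k]
  rw [← h j k l, ← h k l j, ← h l j k]
  simp only [curv, map_sub]
  ring

theorem IsHom.horizontal_bianchi_contract (hg : S.IsHom g) (i k l : Fin n) :
    (S.δ g l (S.riem g i k) + ∑ s, S.riem g s k * S.berw g i s l
      + ∑ j, S.curv g i j k * S.conn g j l)
      - (S.δ g k (S.riem g i l) + ∑ s, S.riem g s l * S.berw g i s k
        + ∑ j, S.curv g i j l * S.conn g j k)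
      + S.sprayField g (S.curv g i k l) + ∑ s, S.curv g s k l * S.conn g i s = 0 := by
  have h1 : ∀ k l, ∑ j, S.y j * S.δ g l (S.curv g i j k)
      = S.δ g l (S.riem g i k) + ∑ j, S.curv g i j k * S.conn g j l := fun k l ↦ by
    simp [hg.riem_eq, S.δ_y, sum_add_distrib]
  have h2 : ∀ k l, ∑ j, S.y j * ∑ s, S.curv g s j k * S.berw g i s l
      = ∑ s, S.riem g s k * S.berw g i s l := fun k l ↦ by
    simp only [hg.riem_eq, sum_mul, mul_sum]
    rw [sum_comm]
    simp only [mul_assoc]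
  have h3 : ∑ j, S.y j * ∑ s, S.curv g s k l * S.berw g i s j
      = ∑ s, S.curv g s k l * S.conn g i s := by
    simp only [← hg.sum_y_berw' i, mul_sum]
    rw [sum_comm]
    refine sum_congr rfl fun s _ ↦ sum_congr rfl fun j _ ↦ ?_
    ring
  have hb := sum_congr rfl fun j (_ : j ∈ univ) ↦
    congrArg (S.y j * ·) (S.horizontal_bianchi (g := g) i j k l)
  simp only [mul_zero, sum_const_zero, mul_add, sum_add_distrib, h1 k l, h2 k l, h3,
    ← sprayField_apply,
    S.curv_antisymm _ l, neg_mul, mul_neg, map_neg, sum_neg_distrib, h1 l k, h2 l k] at hb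
  linear_combination hb

/-- The trace `Rᵐₖₘ` of the curvature of the nonlinear connection. -/
def curvTrace (S : CoordAlg n A) (g : Fin n → A) (k : Fin n) : A := ∑ m, S.curv g m k m

/-- The trace `Aᵐₖ|ₘ` of the horizontal covariant derivative. -/
def divg (S : CoordAlg n A) (g : Fin n → A) (T : Fin n → Fin n → A) (k : Fin n) : A :=
  ∑ m, (S.δ g m (T m k) + ∑ l, T l k * S.berw g m l m - ∑ l, T m l * S.berw g l k m)

theorem IsHom.divg_riem (hg : S.IsHom g) (k : Fin n) :
    S.divg g (S.riem g) k = S.δ g k (∑ m, S.riem g m m) - S.sprayField g (S.curvTrace g k)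
      + ∑ j, S.curvTrace g j * S.conn g j k := by
  have hb := sum_congr rfl fun m (_ : m ∈ univ) ↦ hg.horizontal_bianchi_contract m k m
  have h1 : ∑ m, ∑ j, S.curv g m j k * S.conn g j m
      = - ∑ m, ∑ s, S.curv g s k m * S.conn g m s := by
    rw [sum_comm, ← sum_neg_distrib]
    refine sum_congr rfl fun m _ ↦ ?_
    rw [← sum_neg_distrib]
    refine sum_congr rfl fun s _ ↦ ?_
    rw [S.curv_antisymm]; ring
  have h2 : ∑ m, ∑ j, S.curv g m j m * S.conn g j k = ∑ j, S.curvTrace g j * S.conn g j k := by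
    simp only [curvTrace, sum_mul]
    rw [sum_comm]
  have h3 : ∑ m, ∑ s, S.riem g s m * S.berw g m s k
      = ∑ m, ∑ l, S.riem g m l * S.berw g l k m := by
    rw [sum_comm]
    simp only [S.berw_comm g _ k]
  simp only [sum_add_distrib, sum_sub_distrib, h1, h2, h3, sum_const_zero] at hb
  simp only [divg, sum_add_distrib, sum_sub_distrib, map_sum]
  simp only [curvTrace, map_sum] at hb ⊢
  linear_combination hb

theorem IsHom.three_curvTrace (hg : S.IsHom g) (k : Fin n) :
    3 * S.curvTrace g k = S.Y k (∑ m, S.riem g m m) - ∑ m, S.Y m (S.riem g m k) := by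
  simp only [curvTrace, mul_sum, hg.three_curv, sum_sub_distrib, map_sum]

theorem IsHom.sum_Y_riem (hg : S.IsHom g) {L : A} (hx : ∀ i, S.Y i L = 0)
    (hL : ∑ m, S.conn g m m = ∑ m, S.y m * S.X m L) (k : Fin n) :
    ∑ m, S.Y m (S.riem g m k) = - S.curvTrace g k := by
  have hΓ : ∀ j, ∑ m, S.berw g m j m = S.X j L := fun j ↦ by
    have h := congrArg (S.Y j) hL
    simpa [Y_conn, S.Y_y, ← S.X_Y, hx, S.berw_comm g _ _ j] using h
  have hδ : ∀ j k, ∑ m, S.δ g j (S.berw g m k m) = S.X j (S.X k L) := fun j k ↦ by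
    rw [← map_sum, hΓ, δ_apply]
    simp [← S.X_Y, hx]
  have hc : ∀ j k, ∑ m, S.Y m (S.curv g m j k) = 0 := fun j k ↦ by
    simp only [curv, map_sub, Y_δ, Y_conn, sum_sub_distrib]
    rw [hδ, hδ, S.X_X, sum_comm (f := fun m l ↦ S.berw g l k m * S.berw g m j l)]
    simp only [mul_comm (S.berw g _ k _)]
    ring
  simp only [hg.riem_eq, map_sum, Derivation.leibniz, smul_eq_mul, S.Y_y, sum_add_distrib]
  rw [sum_comm]
  simp only [← mul_sum, hc]
  simp [curvTrace, S.curv_antisymm _ k]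

/-- The Ricci scalar. -/
def ricci (S : CoordAlg n A) (g : Fin n → A) : A :=
  algebraMap ℝ A ((n : ℝ) - 1)⁻¹ * ∑ m, S.riem g m m

/-- The trace-adjusted Riemann curvature. -/
def tcurv (S : CoordAlg n A) (g : Fin n → A) (i k : Fin n) : A :=
  S.riem g i k - (S.ricci g * (if i = k then 1 else 0)
    - algebraMap ℝ A (1 / 2) * S.Y k (S.ricci g) * S.y i)

/-- The χ-curvature. -/
def chi (S : CoordAlg n A) (g : Fin n → A) (i : Fin n) : A :=
  algebraMap ℝ A (-(1 / 3)) * ∑ m, S.Y m (S.tcurv g m i)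

/-- The Weyl curvature. -/
def weyl (S : CoordAlg n A) (g : Fin n → A) (i k : Fin n) : A :=
  S.tcurv g i k + algebraMap ℝ A ((n : ℝ) + 1)⁻¹ * (3 * S.chi g k) * S.y i

/-- The S-curvature of a volume form with log-density `L`. -/
def scurv (S : CoordAlg n A) (g : Fin n → A) (L : A) : A :=
  ∑ m, S.conn g m m - ∑ m, S.y m * S.X m L

/-- The projective spray of a volume form with log-density `L`. -/
def proj (S : CoordAlg n A) (g : Fin n → A) (L : A) (i : Fin n) : A :=
  g i - algebraMap ℝ A ((n : ℝ) + 1)⁻¹ * S.scurv g L * S.y i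

/-- The covector `R|ₖ - ½ R·ₖ|ₘ yᵐ`. -/
def cotton (S : CoordAlg n A) (g : Fin n → A) (k : Fin n) : A :=
  S.δ g k (S.ricci g) - algebraMap ℝ A (1 / 2) *
    ∑ m, (S.δ g m (S.Y k (S.ricci g)) - ∑ l, S.Y l (S.ricci g) * S.berw g l k m) * S.y m

theorem natCast_mul_algebraMap_inv (hn : (n : ℝ) - 1 ≠ 0) :
    ((n : A) - 1) * algebraMap ℝ A ((n : ℝ) - 1)⁻¹ = 1 := by
  have : (n : A) - 1 = algebraMap ℝ A ((n : ℝ) - 1) := by simp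
  rw [this, ← map_mul, mul_inv_cancel₀ hn, map_one]

theorem natCast_add_mul_algebraMap_inv : ((n : A) + 1) * algebraMap ℝ A ((n : ℝ) + 1)⁻¹ = 1 := by
  have : (n : A) + 1 = algebraMap ℝ A ((n : ℝ) + 1) := by simp
  rw [this, ← map_mul, mul_inv_cancel₀ (by positivity), map_one]

theorem two_mul_algebraMap_half : 2 * algebraMap ℝ A (1 / 2) = 1 := by
  have : (2 : A) = algebraMap ℝ A 2 := (map_ofNat _ 2).symm
  rw [this, ← map_mul]; norm_num

theorem three_mul_algebraMap_third : 3 * algebraMap ℝ A (-(1 / 3)) = -1 := by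
  have : (3 : A) = algebraMap ℝ A 3 := (map_ofNat _ 3).symm
  rw [this, ← map_mul]; norm_num

theorem isUnit_two (A : Type*) [CommRing A] [Algebra ℝ A] : IsUnit (2 : A) :=
  IsUnit.of_mul_eq_one _ two_mul_algebraMap_half

theorem sum_riem (hn : (n : ℝ) - 1 ≠ 0) :
    ∑ m, S.riem g m m = ((n : A) - 1) * S.ricci g := by
  rw [ricci, ← mul_assoc, natCast_mul_algebraMap_inv hn, one_mul]

theorem Y_natCast_mul (D : Derivation ℝ A A) (f : A) :
    D (((n : A) - 1) * f) = ((n : A) - 1) * D f := by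
  simp

theorem IsHom.euler_ricci (hg : S.IsHom g) : S.euler (S.ricci g) = 2 * S.ricci g := by
  simp only [ricci, Derivation.leibniz, Derivation.map_algebraMap, map_sum, hg.euler_riem,
    smul_eq_mul, ← mul_sum]
  ring

theorem IsHom.euler_Y_ricci (hg : S.IsHom g) (k : Fin n) :
    S.euler (S.Y k (S.ricci g)) = S.Y k (S.ricci g) := by
  have h := S.Y_euler k (S.ricci g)
  rw [hg.euler_ricci] at h
  simp [Derivation.map_two] at h
  linear_combination -h

theorem sum_Y_mul_y (a : A) : ∑ m, S.Y m (a * S.y m) = S.euler a + n * a := by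
  simp [S.Y_y, sum_add_distrib, euler_apply]
  ring

theorem IsHom.sum_Y_tcurv (hg : S.IsHom g) (k : Fin n) :
    ∑ m, S.Y m (S.tcurv g m k) = ∑ m, S.Y m (S.riem g m k)
      + algebraMap ℝ A (1 / 2) * ((n : A) - 1) * S.Y k (S.ricci g) := by
  have h1 : ∑ m, S.Y m (S.ricci g * (if m = k then 1 else 0)) = S.Y k (S.ricci g) := by
    rw [sum_eq_single k] <;> simp +contextual
  simp only [tcurv, map_sub, sum_sub_distrib, h1, S.sum_Y_mul_y]
  simp only [Derivation.leibniz, Derivation.map_algebraMap, smul_eq_mul, hg.euler_Y_ricci]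
  linear_combination S.Y k (S.ricci g) * two_mul_algebraMap_half (A := A)

theorem IsHom.two_curvTrace (hg : S.IsHom g) (hn : (n : ℝ) - 1 ≠ 0) {L : A}
    (hx : ∀ i, S.Y i L = 0)
    (hL : ∑ m, S.conn g m m = ∑ m, S.y m * S.X m L) (k : Fin n) :
    2 * S.curvTrace g k = ((n : A) - 1) * S.Y k (S.ricci g) := by
  have h := hg.three_curvTrace k
  rw [hg.sum_Y_riem hx hL, sum_riem hn, Y_natCast_mul] at h
  linear_combination h

theorem IsHom.curvTrace_eq (hg : S.IsHom g) (hn : (n : ℝ) - 1 ≠ 0) {L : A}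
    (hx : ∀ i, S.Y i L = 0)
    (hL : ∑ m, S.conn g m m = ∑ m, S.y m * S.X m L) (k : Fin n) :
    S.curvTrace g k = algebraMap ℝ A (1 / 2) * (((n : A) - 1) * S.Y k (S.ricci g)) := by
  rw [← hg.two_curvTrace hn hx hL]
  linear_combination -S.curvTrace g k * two_mul_algebraMap_half (A := A)

theorem IsHom.sum_Y_tcurv_eq_zero (hg : S.IsHom g) (hn : (n : ℝ) - 1 ≠ 0) {L : A}
    (hx : ∀ i, S.Y i L = 0)
    (hL : ∑ m, S.conn g m m = ∑ m, S.y m * S.X m L) (k : Fin n) :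
    ∑ m, S.Y m (S.tcurv g m k) = 0 := by
  rw [hg.sum_Y_tcurv, hg.sum_Y_riem hx hL, hg.curvTrace_eq hn hx hL]
  ring

theorem IsHom.divg_tcurv (hg : S.IsHom g) (k : Fin n) :
    S.divg g (S.tcurv g) k = S.divg g (S.riem g) k - S.cotton g k := by
  have e1 : ∑ m, S.δ g m (S.ricci g * (if m = k then 1 else 0)) = S.δ g k (S.ricci g) := by
    rw [sum_eq_single k] <;> simp +contextual
  have e2 : ∑ m, S.δ g m (algebraMap ℝ A (1 / 2) * S.Y k (S.ricci g) * S.y m)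
      = algebraMap ℝ A (1 / 2) * (∑ m, S.δ g m (S.Y k (S.ricci g)) * S.y m
        - S.Y k (S.ricci g) * ∑ m, S.conn g m m) := by
    simp only [Derivation.leibniz, smul_eq_mul, δ_y, Derivation.map_algebraMap, mul_sub, mul_sum,
      ← sum_sub_distrib]
    refine sum_congr rfl fun m _ ↦ ?_
    ring
  have e3 : ∑ m, ∑ l, algebraMap ℝ A (1 / 2) * S.Y k (S.ricci g) * S.y l * S.berw g m l m
      = algebraMap ℝ A (1 / 2) * (S.Y k (S.ricci g) * ∑ m, S.conn g m m) := by
    simp only [mul_assoc, ← mul_sum, hg.sum_y_berw]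
  have e4 : ∑ m, ∑ l, algebraMap ℝ A (1 / 2) * S.Y l (S.ricci g) * S.y m * S.berw g l k m
      = algebraMap ℝ A (1 / 2)
        * ∑ m, (∑ l, S.Y l (S.ricci g) * S.berw g l k m) * S.y m := by
    simp only [mul_sum, sum_mul]
    refine sum_congr rfl fun m _ ↦ sum_congr rfl fun l _ ↦ ?_
    ring
  simp only [divg, tcurv, cotton, map_sub, sub_mul, sum_sub_distrib, sum_add_distrib, e1, e2, e3,
    e4]
  simp [S.berw_comm g _ k]
  ring

theorem IsHom.divg_tcurv_eq (hg : S.IsHom g) (hn : (n : ℝ) - 1 ≠ 0) {L : A}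
    (hx : ∀ i, S.Y i L = 0)
    (hL : ∑ m, S.conn g m m = ∑ m, S.y m * S.X m L) (k : Fin n) :
    S.divg g (S.tcurv g) k = ((n : A) - 2) * S.cotton g k := by
  have hc : S.cotton g k = S.δ g k (S.ricci g) - algebraMap ℝ A (1 / 2) *
      (S.sprayField g (S.Y k (S.ricci g)) - ∑ l, S.Y l (S.ricci g) * S.conn g l k) := by
    simp only [cotton, sub_mul, sum_sub_distrib, sprayField_apply, ← hg.sum_y_berw', mul_sum,
      sum_mul]
    rw [sum_comm (f := fun m l ↦ S.Y l (S.ricci g) * S.berw g l k m * S.y m)]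
    simp only [mul_assoc, mul_comm, mul_left_comm]
  rw [hg.divg_tcurv, hg.divg_riem, sum_riem hn, Y_natCast_mul, hc]
  simp only [hg.curvTrace_eq hn hx hL, Derivation.leibniz, smul_eq_mul, Derivation.map_algebraMap,
    mul_assoc, ← mul_sum]
  simp
  ring

theorem IsHom.tcurv_contract (hg : S.IsHom g) (i : Fin n) :
    ∑ k, S.tcurv g i k * S.y k = 0 := by
  have h := hg.euler_ricci
  rw [euler_apply] at h
  have h2 : ∑ k, algebraMap ℝ A (1 / 2) * S.Y k (S.ricci g) * S.y i * S.y k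
      = algebraMap ℝ A (1 / 2) * S.y i * (2 * S.ricci g) := by
    rw [← h, mul_sum]
    refine sum_congr rfl fun k _ ↦ ?_
    ring
  simp only [tcurv, sub_mul, sum_sub_distrib, hg.riem_contract (isUnit_two A), h2]
  simp [-one_div]
  linear_combination S.ricci g * S.y i * two_mul_algebraMap_half (A := A)

theorem IsHom.tcurv_trace (hg : S.IsHom g) (hn : (n : ℝ) - 1 ≠ 0) :
    ∑ m, S.tcurv g m m = 0 := by
  have h := hg.euler_ricci
  rw [euler_apply] at h
  have h2 : ∑ k, algebraMap ℝ A (1 / 2) * S.Y k (S.ricci g) * S.y k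
      = algebraMap ℝ A (1 / 2) * (2 * S.ricci g) := by
    rw [← h, mul_sum]
    refine sum_congr rfl fun k _ ↦ ?_
    ring
  simp only [tcurv, sum_sub_distrib, h2, sum_riem hn]
  simp [-one_div]
  linear_combination S.ricci g * two_mul_algebraMap_half (A := A)

theorem IsHom.euler_tcurv (hg : S.IsHom g) (i k : Fin n) :
    S.euler (S.tcurv g i k) = 2 * S.tcurv g i k := by
  have : S.euler (if i = k then 1 else 0 : A) = 0 := by split_ifs <;> simp
  simp only [tcurv, map_sub, Derivation.leibniz, smul_eq_mul, hg.euler_riem, hg.euler_ricci,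
    hg.euler_Y_ricci, euler_y, Derivation.map_algebraMap, this]
  ring

theorem weyl_eq_tcurv (h : ∀ k, ∑ m, S.Y m (S.tcurv g m k) = 0) : S.weyl g = S.tcurv g := by
  funext i k
  simp [weyl, chi, h]

section Projective

variable {P : A} {g' : Fin n → A}

theorem conn_projective (hg' : ∀ i, g' i = g i + P * S.y i) (i j : Fin n) :
    S.conn g' i j = S.conn g i j + S.Y j P * S.y i + P * (if j = i then 1 else 0) := by
  rw [conn, hg', map_add, Derivation.leibniz, Y_y]
  simp only [smul_eq_mul, conn]
  ring

theorem berw_projective (hg' : ∀ i, g' i = g i + P * S.y i) (i j k : Fin n) :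
    S.berw g' i j k = S.berw g i j k + S.Y k (S.Y j P) * S.y i
      + S.Y j P * (if k = i then 1 else 0) + S.Y k P * (if j = i then 1 else 0) := by
  have : S.Y k (if j = i then 1 else 0 : A) = 0 := by split_ifs <;> simp
  rw [← Y_conn, conn_projective hg']
  simp only [map_add, Derivation.leibniz, Y_y, smul_eq_mul, this, Y_conn]
  ring

theorem δ_projective (hg' : ∀ i, g' i = g i + P * S.y i) (k : Fin n) (f : A) :
    S.δ g' k f = S.δ g k f - S.Y k P * S.euler f - P * S.Y k f := by
  simp only [δ_apply, conn_projective hg', euler_apply, add_mul, sum_add_distrib, mul_assoc,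
    ← mul_sum]
  simp
  ring

theorem IsHom.projective (hg : S.IsHom g) (hP : S.euler P = P)
    (hg' : ∀ i, g' i = g i + P * S.y i) : S.IsHom g' := fun i ↦ by
  rw [hg', map_add, Derivation.leibniz, hP, hg i, euler_y, smul_eq_mul, smul_eq_mul]
  ring

theorem euler_Y_of_one (hP : S.euler P = P) (k : Fin n) : S.euler (S.Y k P) = 0 := by
  have h := S.Y_euler k P
  rw [hP] at h
  linear_combination -h

/-- The scalar part of the change of the Riemann curvature under a projective change. -/
def projScalar (S : CoordAlg n A) (g : Fin n → A) (P : A) : A :=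
  P ^ 2 - ∑ j, S.y j * S.X j P + 2 * ∑ j, g j * S.Y j P

/-- The covector part of the change of the Riemann curvature under a projective change. -/
def projCovector (S : CoordAlg n A) (g : Fin n → A) (P : A) (k : Fin n) : A :=
  2 * S.X k P - ∑ j, S.y j * S.X j (S.Y k P) + 2 * ∑ j, g j * S.Y k (S.Y j P)
    - ∑ s, S.Y s P * S.conn g s k - P * S.Y k P

theorem IsHom.riem_projective (hg : S.IsHom g) (hP : S.euler P = P)
    (hg' : ∀ i, g' i = g i + P * S.y i) (i k : Fin n) :
    S.riem g' i k = S.riem g i k + S.projScalar g P * (if i = k then 1 else 0)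
      + S.projCovector g P k * S.y i := by
  have e1 : ∑ j, S.y j * S.Y k (S.X j (g' i)) = ∑ j, S.y j * S.Y k (S.X j (g i))
      + (∑ j, S.y j * S.X j (S.Y k P)) * S.y i
      + (∑ j, S.y j * S.X j P) * (if i = k then 1 else 0) := by
    simp only [hg', map_add, Derivation.leibniz, X_y, Y_y, smul_eq_mul, sum_mul,
      ← sum_add_distrib, S.X_Y]
    refine sum_congr rfl fun j _ ↦ ?_
    simp only [eq_comm (a := i)]
    split_ifs <;> simp <;> ring_nf
  have e2 : ∑ j, S.y j * S.berw g' i j k = S.conn g' i k :=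
    (hg.projective hP hg').sum_y_berw i k
  have e3 : ∑ j, g' j * S.berw g' i j k
      = ∑ j, g j * S.berw g' i j k + P * S.conn g' i k := by
    rw [← e2, mul_sum, ← sum_add_distrib]
    refine sum_congr rfl fun j _ ↦ ?_
    rw [hg' j]; ring
  have e4 : ∑ j, g j * S.berw g' i j k
      = ∑ j, g j * S.berw g i j k + (∑ j, g j * S.Y k (S.Y j P)) * S.y i
        + (∑ j, g j * S.Y j P) * (if i = k then 1 else 0) + S.Y k P * g i := by
    simp only [berw_projective hg', mul_add, sum_add_distrib, sum_mul]
    simp [eq_comm (a := i), mul_assoc]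
    ring
  have e5 : ∑ s, S.conn g' i s * S.conn g' s k
      = ∑ s, S.conn g i s * S.conn g s k + 2 * g i * S.Y k P + 2 * P * S.conn g i k
        + S.y i * ∑ s, S.Y s P * S.conn g s k + 3 * P * S.Y k P * S.y i
        + P ^ 2 * (if i = k then 1 else 0) := by
    have h1 : ∑ s, S.conn g i s * (S.Y k P * S.y s) = S.Y k P * (2 * g i) := by
      rw [← hg.sum_y_conn, mul_sum]
      refine sum_congr rfl fun s _ ↦ ?_
      ring
    have h2 : ∑ s, S.Y s P * S.y i * (S.Y k P * S.y s) = S.Y k P * S.y i * P := by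
      rw [show S.Y k P * S.y i * P = S.Y k P * S.y i * S.euler P by rw [hP], euler_apply,
        mul_sum]
      refine sum_congr rfl fun s _ ↦ ?_
      ring
    have h3 : ∑ s, S.Y s P * S.y i * S.conn g s k = S.y i * ∑ s, S.Y s P * S.conn g s k := by
      rw [mul_sum]
      refine sum_congr rfl fun s _ ↦ ?_
      ring
    simp only [conn_projective hg', mul_add, add_mul, sum_add_distrib, h1, h2, h3]
    simp [eq_comm (a := i)]
    ring_nf
  simp only [riem, e1, e3, e4, e5]
  rw [conn_projective hg', hg', map_add, Derivation.leibniz, X_y, projScalar, projCovector]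
  simp only [smul_eq_mul, eq_comm (a := i)]
  ring

theorem IsHom.sum_projCovector_mul_y (hg : S.IsHom g) (hP : S.euler P = P) :
    ∑ k, S.projCovector g P k * S.y k = - S.projScalar g P := by
  have h0 := fun k ↦ S.euler_Y_of_one hP k
  have h1 : ∑ k, (∑ j, S.y j * S.X j (S.Y k P)) * S.y k = ∑ j, S.y j * S.X j P := by
    simp only [sum_mul]
    rw [sum_comm]
    refine sum_congr rfl fun j _ ↦ ?_
    nth_rw 2 [← hP]
    rw [X_euler, euler_apply, mul_sum]
    refine sum_congr rfl fun k _ ↦ ?_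
    rw [S.X_Y]; ring
  have h2 : ∑ k, (∑ j, g j * S.Y k (S.Y j P)) * S.y k = 0 := by
    simp only [sum_mul]
    rw [sum_comm]
    refine sum_eq_zero fun j _ ↦ ?_
    rw [← mul_zero (g j), ← h0 j, euler_apply, mul_sum]
    refine sum_congr rfl fun k _ ↦ ?_
    ring
  have h3 : ∑ k, (∑ s, S.Y s P * S.conn g s k) * S.y k = 2 * ∑ j, g j * S.Y j P := by
    simp only [sum_mul, mul_sum]
    rw [sum_comm]
    refine sum_congr rfl fun j _ ↦ ?_
    rw [← mul_assoc, ← hg.sum_y_conn, sum_mul]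
    refine sum_congr rfl fun k _ ↦ ?_
    ring
  have h4 : ∑ k, P * S.Y k P * S.y k = P ^ 2 := by
    rw [show P ^ 2 = P * S.euler P by rw [hP, sq], euler_apply, mul_sum]
    refine sum_congr rfl fun k _ ↦ ?_
    ring
  have h5 : ∑ k, 2 * S.X k P * S.y k = 2 * ∑ j, S.y j * S.X j P := by
    rw [mul_sum]
    refine sum_congr rfl fun k _ ↦ ?_
    ring
  simp only [projCovector, add_mul, sub_mul, sum_add_distrib, sum_sub_distrib, h1, h3, h4, h5,
    mul_assoc (2 : A) (∑ j, _), ← mul_sum, h2]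
  rw [projScalar]
  ring

theorem IsHom.ricci_projective (hg : S.IsHom g) (hn : (n : ℝ) - 1 ≠ 0) (hP : S.euler P = P)
    (hg' : ∀ i, g' i = g i + P * S.y i) : S.ricci g' = S.ricci g + S.projScalar g P := by
  have h : ∑ m, S.riem g' m m = ∑ m, S.riem g m m + ((n : A) - 1) * S.projScalar g P := by
    simp only [hg.riem_projective hP hg', sum_add_distrib, hg.sum_projCovector_mul_y hP]
    simp
    ring
  rw [ricci, h, ricci]
  linear_combination S.projScalar g P * natCast_mul_algebraMap_inv (A := A) hn

/-- The change of the trace-adjusted Riemann curvature under a projective change. -/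
theorem IsHom.tcurv_projective (hg : S.IsHom g) (hn : (n : ℝ) - 1 ≠ 0) (hP : S.euler P = P)
    (hg' : ∀ i, g' i = g i + P * S.y i) (i k : Fin n) :
    S.tcurv g' i k = S.tcurv g i k
      + (S.projCovector g P k + algebraMap ℝ A (1 / 2) * S.Y k (S.projScalar g P)) * S.y i := by
  rw [tcurv, hg.riem_projective hP hg', hg.ricci_projective hn hP hg', tcurv, map_add]
  ring

theorem euler_g_mul (hg : S.IsHom g) (f : A) : S.euler (∑ j, g j * S.Y j f)
    = ∑ j, g j * S.Y j (S.euler f) + ∑ j, g j * S.Y j f := by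
  simp only [map_sum, Derivation.leibniz, smul_eq_mul, hg _, Y_euler, ← sum_add_distrib]
  refine sum_congr rfl fun j _ ↦ ?_
  ring

theorem euler_sum_y_X (f : A) : S.euler (∑ j, S.y j * S.X j f)
    = ∑ j, S.y j * S.X j (S.euler f) + ∑ j, S.y j * S.X j f := by
  simp only [map_sum, Derivation.leibniz, smul_eq_mul, euler_y, X_euler, ← sum_add_distrib]
  refine sum_congr rfl fun j _ ↦ ?_
  ring

theorem IsHom.euler_projScalar (hg : S.IsHom g) (hP : S.euler P = P) :
    S.euler (S.projScalar g P) = 2 * S.projScalar g P := by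
  simp only [projScalar, map_add, map_sub, euler_sum_y_X, Derivation.leibniz, euler_g_mul hg, sq,
    hP, Derivation.map_two, smul_eq_mul]
  ring

theorem IsHom.euler_projCovector (hg : S.IsHom g) (hP : S.euler P = P) (k : Fin n) :
    S.euler (S.projCovector g P k) = S.projCovector g P k := by
  have h0 := fun k ↦ S.euler_Y_of_one hP k
  have h1 : S.euler (∑ s, S.Y s P * S.conn g s k) = ∑ s, S.Y s P * S.conn g s k := by
    simp [h0, hg.euler_conn]
  simp only [projCovector, map_add, map_sub, euler_sum_y_X, Derivation.leibniz, S.Y_Y k,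
    euler_g_mul hg, hP, Derivation.map_two, smul_eq_mul, ← X_euler, h0, h1,
    mul_zero, sum_const_zero, map_zero, add_zero, zero_add]
  ring

theorem IsHom.weyl_projective (hg : S.IsHom g) (hn : (n : ℝ) - 1 ≠ 0) (hP : S.euler P = P)
    (hg' : ∀ i, g' i = g i + P * S.y i) : S.weyl g' = S.weyl g := by
  funext i k
  set θ := S.projCovector g P k + algebraMap ℝ A (1 / 2) * S.Y k (S.projScalar g P) with hθ
  have hθ1 : S.euler θ = θ := by
    have h := S.Y_euler k (S.projScalar g P)
    rw [hg.euler_projScalar hP] at h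
    simp [Derivation.map_two] at h
    simp only [hθ, map_add, Derivation.leibniz, hg.euler_projCovector hP, smul_eq_mul,
      Derivation.map_algebraMap]
    linear_combination -algebraMap ℝ A (1 / 2) * h
  have hY : ∑ m, S.Y m (S.tcurv g' m k) = ∑ m, S.Y m (S.tcurv g m k) + ((n : A) + 1) * θ := by
    simp only [hg.tcurv_projective hn hP hg', map_add, sum_add_distrib, ← hθ, S.sum_Y_mul_y, hθ1]
    ring
  rw [weyl, chi, hY, hg.tcurv_projective hn hP hg', ← hθ, weyl, chi]
  linear_combination (θ * S.y i) * (3 * algebraMap ℝ A (-(1 / 3)) *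
    natCast_add_mul_algebraMap_inv (n := n) (A := A) + three_mul_algebraMap_third (A := A))

theorem divg_projective (hP : S.euler P = P) (hg' : ∀ i, g' i = g i + P * S.y i)
    {T : Fin n → Fin n → A} (hy : ∀ i, ∑ k, T i k * S.y k = 0) (htr : ∑ m, T m m = 0)
    (hdiv : ∀ k, ∑ m, S.Y m (T m k) = 0) (hT : ∀ i k, S.euler (T i k) = 2 * T i k) (k : Fin n) :
    S.divg g' T k = S.divg g T k + ((n : A) - 2) * ∑ m, T m k * S.Y m P := by
  have h0 := fun k ↦ S.euler_Y_of_one hP k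
  have e1 : ∑ m, ∑ l, T l k * (S.Y m (S.Y l P) * S.y m) = 0 := by
    rw [sum_comm]
    refine sum_eq_zero fun l _ ↦ ?_
    rw [← mul_sum, ← mul_zero (T l k), ← h0 l, euler_apply]
    simp only [mul_comm]
  have e2 : ∑ m, ∑ l, T m l * (S.Y m (S.Y k P) * S.y l) = 0 := by
    refine sum_eq_zero fun m _ ↦ ?_
    rw [← mul_zero (S.Y m (S.Y k P)), ← hy m, mul_sum]
    refine sum_congr rfl fun l _ ↦ ?_
    ring
  have e3 : ∑ m, S.Y m P * (2 * T m k) = 2 * ∑ m, T m k * S.Y m P := by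
    rw [mul_sum]
    refine sum_congr rfl fun m _ ↦ ?_
    ring
  simp only [divg, δ_projective hg', berw_projective hg', hT, mul_add, sum_add_distrib,
    sum_sub_distrib, e1, e2, ← mul_sum, hdiv]
  simp [← sum_mul, htr]
  rw [e3]
  ring

end Projective

/-- The horizontal divergence of the Weyl curvature in terms of the projective spray of a volume
form. -/
theorem IsHom.divg_weyl (hg : S.IsHom g) (hn : (n : ℝ) - 1 ≠ 0) {L : A}
    (hx : ∀ i, S.Y i L = 0) (k : Fin n) :
    S.divg g (S.weyl g) k = ((n : A) - 2) * (S.cotton (S.proj g L) k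
      + ∑ m, S.weyl g m k *
        S.Y m (algebraMap ℝ A ((n : ℝ) + 1)⁻¹ * S.scurv g L)) := by
  set Q := algebraMap ℝ A ((n : ℝ) + 1)⁻¹ * S.scurv g L with hQ
  have hL : S.euler L = 0 := by simp [euler_apply, hx]
  have hs : S.euler (S.scurv g L) = S.scurv g L := by
    simp only [scurv, map_sub, euler_sum_y_X, hL]
    simp [hg.euler_conn]
  have hP : S.euler (-Q) = -Q := by simp [hQ, hs]
  have hg' : ∀ i, S.proj g L i = g i + (-Q) * S.y i := fun i ↦ by rw [proj, hQ]; ring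
  have hh := hg.projective hP hg'
  have htr : ∑ m, S.conn (S.proj g L) m m = ∑ m, S.y m * S.X m L := by
    have h1 : ∑ m, S.Y m (-Q) * S.y m = -Q := by
      conv_rhs => rw [← hP, euler_apply]
      simp only [mul_comm]
    simp only [conn_projective hg', sum_add_distrib, h1]
    simp [hQ]
    have hS : S.scurv g L = ∑ m, S.conn g m m - ∑ m, S.y m * S.X m L := rfl
    linear_combination (-S.scurv g L) * natCast_add_mul_algebraMap_inv (n := n) (A := A) - hS
  have hd := hh.sum_Y_tcurv_eq_zero hn hx htr
  have hw : S.weyl g = S.tcurv (S.proj g L) := by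
    rw [← hg.weyl_projective hn hP hg', weyl_eq_tcurv hd]
  have h1 := divg_projective (g := g) hP hg' hh.tcurv_contract (hh.tcurv_trace hn) hd
    hh.euler_tcurv k
  rw [hh.divg_tcurv_eq hn hx htr] at h1
  rw [hw]
  simp only [map_neg, mul_neg, sum_neg_distrib] at h1
  linear_combination -h1

end CoordAlg

section SmoothFunctions

open Set Topology

variable {V : Type*}

/-- Extension by zero of a function on a subset. -/
def extendZero {Ω : Set V} (f : Ω → ℝ) : V → ℝ := Function.extend Subtype.val f 0

theorem extendZero_apply {Ω : Set V} (f : Ω → ℝ) {p : V} (hp : p ∈ Ω) :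
    extendZero f p = f ⟨p, hp⟩ :=
  Subtype.val_injective.extend_apply f 0 ⟨p, hp⟩

theorem extendZero_eqOn {Ω : Set V} {f : Ω → ℝ} {F : V → ℝ} (h : ∀ p : Ω, f p = F p) :
    EqOn (extendZero f) F Ω := fun p hp ↦ by
  rw [extendZero_apply f hp, h]

variable [NormedAddCommGroup V] [NormedSpace ℝ V]

/-- The algebra of smooth real functions on a subset of a normed space. -/
def smoothAlg (Ω : Set V) : Subalgebra ℝ (Ω → ℝ) where
  carrier := {f | ContDiffOn ℝ (⊤ : ℕ∞) (extendZero f) Ω}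
  mul_mem' {f g} hf hg := (hf.mul hg).congr <| extendZero_eqOn fun p ↦ by
    simp [extendZero_apply _ p.2]
  add_mem' {f g} hf hg := (hf.add hg).congr <| extendZero_eqOn fun p ↦ by
    simp [extendZero_apply _ p.2]
  algebraMap_mem' r := (contDiffOn_const (c := r)).congr <| extendZero_eqOn fun p ↦ rfl

/-- Restriction of a smooth function to `Ω`. -/
def smoothAlg.ofContDiffOn {Ω : Set V} (F : V → ℝ) (hF : ContDiffOn ℝ (⊤ : ℕ∞) F Ω) :
    smoothAlg Ω :=
  ⟨fun p ↦ F p, hF.congr <| extendZero_eqOn fun _ ↦ rfl⟩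

theorem smoothAlg.differentiableAt {Ω : Set V} (hΩ : IsOpen Ω) (f : smoothAlg Ω) {p : V}
    (hp : p ∈ Ω) : DifferentiableAt ℝ (extendZero f.1) p :=
  (ContDiffOn.contDiffAt f.2 (hΩ.mem_nhds hp)).differentiableAt (by simp)

theorem fderiv_extendZero {Ω : Set V} (hΩ : IsOpen Ω) {f : Ω → ℝ} {F : V → ℝ}
    (h : ∀ p : Ω, f p = F p) {p : V} (hp : p ∈ Ω) :
    fderiv ℝ (extendZero f) p = fderiv ℝ F p :=
  ((extendZero_eqOn h).eventuallyEq_of_mem (hΩ.mem_nhds hp)).fderiv_eq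

/-- The directional derivative as a derivation of the algebra of smooth functions. -/
def smoothAlg.dirDeriv {Ω : Set V} (hΩ : IsOpen Ω) (v : V) :
    Derivation ℝ (smoothAlg Ω) (smoothAlg Ω) :=
  Derivation.mk'
    { toFun := fun f ↦ smoothAlg.ofContDiffOn (fun p ↦ fderiv ℝ (extendZero f.1) p v)
        ((ContDiffOn.fderiv_of_isOpen f.2 hΩ (m := (⊤ : ℕ∞)) (by simp)).clm_apply
          contDiffOn_const)
      map_add' := fun f g ↦ by
        ext p
        change fderiv ℝ (extendZero (f.1 + g.1)) p v = _
        rw [fderiv_extendZero hΩ (F := extendZero f.1 + extendZero g.1)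
          (fun q ↦ by simp [extendZero_apply _ q.2]) p.2,
          fderiv_add (smoothAlg.differentiableAt hΩ f p.2) (smoothAlg.differentiableAt hΩ g p.2)]
        rfl
      map_smul' := fun c f ↦ by
        ext p
        change fderiv ℝ (extendZero (c • f.1)) p v = _
        rw [fderiv_extendZero hΩ (F := c • extendZero f.1)
          (fun q ↦ by simp [extendZero_apply _ q.2]) p.2,
          fderiv_const_smul (smoothAlg.differentiableAt hΩ f p.2)]
        rfl }
    fun f g ↦ by
      ext p
      change fderiv ℝ (extendZero (f.1 * g.1)) p v = _
      rw [fderiv_extendZero hΩ (F := extendZero f.1 * extendZero g.1)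
        (fun q ↦ by simp [extendZero_apply _ q.2]) p.2,
        fderiv_mul (smoothAlg.differentiableAt hΩ f p.2) (smoothAlg.differentiableAt hΩ g p.2)]
      simp [extendZero_apply _ p.2]
      rfl

theorem smoothAlg.dirDeriv_apply {Ω : Set V} (hΩ : IsOpen Ω) (v : V) (f : smoothAlg Ω) (p : Ω) :
    (smoothAlg.dirDeriv hΩ v f).1 p = fderiv ℝ (extendZero f.1) p v := rfl

theorem smoothAlg.dirDeriv_comm {Ω : Set V} (hΩ : IsOpen Ω) (v w : V) (f : smoothAlg Ω) :
    smoothAlg.dirDeriv hΩ v (smoothAlg.dirDeriv hΩ w f)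
      = smoothAlg.dirDeriv hΩ w (smoothAlg.dirDeriv hΩ v f) := by
  have key : ∀ (v w : V) (p : Ω), (smoothAlg.dirDeriv hΩ v (smoothAlg.dirDeriv hΩ w f)).1 p
      = fderiv ℝ (fderiv ℝ (extendZero f.1)) p v w := fun v w p ↦ by
    have hd : DifferentiableAt ℝ (fderiv ℝ (extendZero f.1)) p :=
      ((ContDiffOn.fderiv_of_isOpen f.2 hΩ (m := (⊤ : ℕ∞)) (by simp)).contDiffAt
        (hΩ.mem_nhds p.2)).differentiableAt (by simp)
    rw [smoothAlg.dirDeriv_apply, fderiv_extendZero hΩ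
      (f := (smoothAlg.dirDeriv hΩ w f).1) (F := fun q ↦ fderiv ℝ (extendZero f.1) q w)
      (fun q ↦ rfl) p.2,
      fderiv_clm_apply hd (differentiableAt_const w)]
    simp
  ext p
  rw [key, key]
  exact (ContDiffAt.isSymmSndFDerivAt (ContDiffOn.contDiffAt f.2 (hΩ.mem_nhds p.2))
    (by simpa using WithTop.coe_le_coe.2 (le_top (a := (2 : ℕ∞))))) v w

end SmoothFunctions

section Coordinates

open Set Topology CoordAlg

variable {n : ℕ} {Ω : Set (Vec n × Vec n)}

/-- The coordinate derivations on smooth functions on an open subset of `ℝⁿ × ℝⁿ`. -/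
def coordAlg (hΩ : IsOpen Ω) : CoordAlg n (smoothAlg Ω) where
  X i := smoothAlg.dirDeriv hΩ (Pi.single i 1, 0)
  Y i := smoothAlg.dirDeriv hΩ (0, Pi.single i 1)
  y i := smoothAlg.ofContDiffOn (fun p ↦ p.2 i) (by fun_prop)
  X_X _ _ f := smoothAlg.dirDeriv_comm ..
  X_Y _ _ f := smoothAlg.dirDeriv_comm ..
  Y_Y _ _ f := smoothAlg.dirDeriv_comm ..
  X_y i j := by
    ext p
    rw [smoothAlg.dirDeriv_apply, fderiv_extendZero hΩ
      (f := (smoothAlg.ofContDiffOn (fun p : Vec n × Vec n ↦ p.2 j)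
        (by fun_prop)).1)
      (F := (ContinuousLinearMap.proj (R := ℝ) (φ := fun _ : Fin n ↦ ℝ) j).comp
        (ContinuousLinearMap.snd ℝ (Vec n) (Vec n))) (fun q ↦ rfl) p.2,
      ContinuousLinearMap.fderiv]
    simp
  Y_y i j := by
    ext p
    rw [smoothAlg.dirDeriv_apply, fderiv_extendZero hΩ
      (f := (smoothAlg.ofContDiffOn (fun p : Vec n × Vec n ↦ p.2 j)
        (by fun_prop)).1)
      (F := (ContinuousLinearMap.proj (R := ℝ) (φ := fun _ : Fin n ↦ ℝ) j).comp
        (ContinuousLinearMap.snd ℝ (Vec n) (Vec n))) (fun q ↦ rfl) p.2,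
      ContinuousLinearMap.fderiv]
    split_ifs with h <;> simp [h, eq_comm]

/-- The element `a` of the algebra of smooth functions is given by `f` on `Ω`. -/
def IsGivenBy (a : smoothAlg Ω) (f : Vec n → Vec n → ℝ) : Prop :=
  ∀ x y, ∀ h : (x, y) ∈ Ω, a.1 ⟨(x, y), h⟩ = f x y

namespace IsGivenBy

variable {a b : smoothAlg Ω} {f f' : Vec n → Vec n → ℝ}

theorem add (h : IsGivenBy a f) (h' : IsGivenBy b f') :
    IsGivenBy (a + b) fun x y ↦ f x y + f' x y :=
  fun x y hp ↦ congrArg₂ (· + ·) (h x y hp) (h' x y hp)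

theorem sub (h : IsGivenBy a f) (h' : IsGivenBy b f') :
    IsGivenBy (a - b) fun x y ↦ f x y - f' x y :=
  fun x y hp ↦ congrArg₂ (· - ·) (h x y hp) (h' x y hp)

theorem mul (h : IsGivenBy a f) (h' : IsGivenBy b f') :
    IsGivenBy (a * b) fun x y ↦ f x y * f' x y :=
  fun x y hp ↦ congrArg₂ (· * ·) (h x y hp) (h' x y hp)

theorem sum {ι : Type*} {s : Finset ι} {a : ι → smoothAlg Ω} {f : ι → Vec n → Vec n → ℝ}
    (h : ∀ i, IsGivenBy (a i) (f i)) : IsGivenBy (∑ i ∈ s, a i) fun x y ↦ ∑ i ∈ s, f i x y :=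
  fun x y hp ↦ by
    simp only [AddSubmonoidClass.coe_finsetSum, Finset.sum_apply]
    exact Finset.sum_congr rfl fun i _ ↦ h i x y hp

theorem const (r : ℝ) : IsGivenBy (algebraMap ℝ (smoothAlg Ω) r) fun _ _ ↦ r :=
  fun _ _ _ ↦ rfl

theorem ite (p : Prop) [Decidable p] :
    IsGivenBy (if p then 1 else 0 : smoothAlg Ω) fun _ _ ↦ if p then 1 else 0 :=
  fun _ _ _ ↦ by split_ifs <;> rfl

theorem congr (h : IsGivenBy a f) (hf : ∀ x y, f x y = f' x y) : IsGivenBy a f' :=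
  fun x y hp ↦ (h x y hp).trans (hf x y)

variable (hΩ : IsOpen Ω)

theorem y (i : Fin n) : IsGivenBy ((coordAlg hΩ).y i) fun _ y ↦ y i := fun _ _ _ ↦ rfl

theorem pdx (h : IsGivenBy a f) (i : Fin n) :
    IsGivenBy ((coordAlg hΩ).X i a) (pdx f i) := fun x y hp ↦ by
  have hd := HasFDerivAt.comp x (f := fun x' ↦ (x', y))
    (smoothAlg.differentiableAt hΩ a hp).hasFDerivAt (hasFDerivAt_prodMk_left x y)
  have he : (fun x' ↦ f x' y) =ᶠ[𝓝 x] extendZero a.1 ∘ fun x' ↦ (x', y) := by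
    filter_upwards [(hΩ.preimage (Continuous.prodMk_left y)).mem_nhds hp] with x' hx'
    rw [Function.comp_apply, extendZero_apply a.1 hx', h x' y hx']
  rw [_root_.pdx, he.fderiv_eq, hd.fderiv]
  rfl

theorem pdy (h : IsGivenBy a f) (i : Fin n) :
    IsGivenBy ((coordAlg hΩ).Y i a) (pdy f i) := fun x y hp ↦ by
  have hd := HasFDerivAt.comp y (f := fun y' ↦ (x, y'))
    (smoothAlg.differentiableAt hΩ a hp).hasFDerivAt (hasFDerivAt_prodMk_right x y)
  have he : (fun y' ↦ f x y') =ᶠ[𝓝 y] extendZero a.1 ∘ fun y' ↦ (x, y') := by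
    filter_upwards [(hΩ.preimage (Continuous.prodMk_right x)).mem_nhds hp] with y' hy'
    rw [Function.comp_apply, extendZero_apply a.1 hy', h x y' hy']
  rw [_root_.pdy, he.fderiv_eq, hd.fderiv]
  rfl

variable {g : Fin n → smoothAlg Ω} {G : Fin n → Vec n → Vec n → ℝ}

theorem conn (hg : ∀ i, IsGivenBy (g i) (G i)) (i j : Fin n) :
    IsGivenBy ((coordAlg hΩ).conn g i j) (Nc G i j) := (hg i).pdy hΩ j

theorem berw (hg : ∀ i, IsGivenBy (g i) (G i)) (i j k : Fin n) :
    IsGivenBy ((coordAlg hΩ).berw g i j k) (Γc G i j k) :=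
  ((hg i).pdy hΩ j).pdy hΩ k

theorem hD (hg : ∀ i, IsGivenBy (g i) (G i)) (h : IsGivenBy a f) (k : Fin n) :
    IsGivenBy ((coordAlg hΩ).δ g k a) (hD G f k) := by
  rw [δ_apply]
  exact (h.pdx hΩ k).sub (sum fun l ↦ (conn hΩ hg l k).mul (h.pdy hΩ l))

theorem riem (hg : ∀ i, IsGivenBy (g i) (G i)) (i k : Fin n) :
    IsGivenBy ((coordAlg hΩ).riem g i k) (Riem G i k) :=
  ((((const 2).mul ((hg i).pdx hΩ k)).sub
    (sum fun j ↦ (y hΩ j).mul (((hg i).pdx hΩ j).pdy hΩ k))).add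
    ((const 2).mul (sum fun j ↦ (hg j).mul (berw hΩ hg i j k)))).sub
    (sum fun s ↦ (conn hΩ hg i s).mul (conn hΩ hg s k))

theorem ricci (hg : ∀ i, IsGivenBy (g i) (G i)) : IsGivenBy ((coordAlg hΩ).ricci g) (Ricci G) :=
  ((const _).mul (sum fun m ↦ riem hΩ hg m m)).congr fun x y ↦ by
    rw [Ricci, div_eq_inv_mul]

theorem tcurv (hg : ∀ i, IsGivenBy (g i) (G i)) (i k : Fin n) :
    IsGivenBy ((coordAlg hΩ).tcurv g i k) (Tcurv G i k) :=
  (riem hΩ hg i k).sub (((ricci hΩ hg).mul (ite _)).sub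
    (((const _).mul ((ricci hΩ hg).pdy hΩ k)).mul (y hΩ i)))

theorem chi (hg : ∀ i, IsGivenBy (g i) (G i)) (i : Fin n) :
    IsGivenBy ((coordAlg hΩ).chi g i) (chiC G i) :=
  (const _).mul (sum fun m ↦ (tcurv hΩ hg m i).pdy hΩ m)

theorem weyl (hg : ∀ i, IsGivenBy (g i) (G i)) (i k : Fin n) :
    IsGivenBy ((coordAlg hΩ).weyl g i k) (Weyl G i k) :=
  ((tcurv hΩ hg i k).add (((const _).mul ((const 3).mul (chi hΩ hg k))).mul
    (y hΩ i))).congr fun x y ↦ by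
      rw [Weyl, div_eq_inv_mul]

theorem divg (hg : ∀ i, IsGivenBy (g i) (G i)) {a : Fin n → Fin n → smoothAlg Ω}
    {T : Fin n → Fin n → Vec n → Vec n → ℝ}
    (hT : ∀ i k, IsGivenBy (a i k) (T i k)) (k : Fin n) :
    IsGivenBy ((coordAlg hΩ).divg g a k) fun x y ↦ ∑ m, covD11 G T m k m x y :=
  sum fun m ↦ ((hD hΩ hg (hT m k) m).add (sum fun l ↦ (hT l k).mul (berw hΩ hg m l m))).sub
    (sum fun l ↦ (hT m l).mul (berw hΩ hg l k m))

theorem scurv (hg : ∀ i, IsGivenBy (g i) (G i)) {σ : Vec n → ℝ}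
    (ha : IsGivenBy a fun x _ ↦ Real.log (σ x)) :
    IsGivenBy ((coordAlg hΩ).scurv g a) (Scurv G σ) :=
  (sum fun m ↦ conn hΩ hg m m).sub (sum fun m ↦ (y hΩ m).mul (ha.pdx hΩ m))

theorem scurv_div (hg : ∀ i, IsGivenBy (g i) (G i)) {σ : Vec n → ℝ}
    (ha : IsGivenBy a fun x _ ↦ Real.log (σ x)) :
    IsGivenBy (algebraMap ℝ (smoothAlg Ω) ((n : ℝ) + 1)⁻¹ * (coordAlg hΩ).scurv g a)
      fun x y ↦ Scurv G σ x y / ((n : ℝ) + 1) :=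
  ((const _).mul (scurv hΩ hg ha)).congr fun _ _ ↦ (div_eq_inv_mul ..).symm

theorem proj (hg : ∀ i, IsGivenBy (g i) (G i)) {σ : Vec n → ℝ}
    (ha : IsGivenBy a fun x _ ↦ Real.log (σ x)) (i : Fin n) :
    IsGivenBy ((coordAlg hΩ).proj g a i) (Ghat G σ i) :=
  (hg i).sub ((scurv_div hΩ hg ha).mul (y hΩ i))

theorem cotton_proj (hg : ∀ i, IsGivenBy (g i) (G i)) {σ : Vec n → ℝ}
    (ha : IsGivenBy a fun x _ ↦ Real.log (σ x)) (k : Fin n) :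
    IsGivenBy ((coordAlg hΩ).cotton ((coordAlg hΩ).proj g a) k) (BWeyl G σ k) :=
  have hp := proj hΩ hg ha
  (hD hΩ hp (ricci hΩ hp) k).sub ((const _).mul (sum fun m ↦
    ((hD hΩ hp ((ricci hΩ hp).pdy hΩ k) m).sub
      (sum fun l ↦ ((ricci hΩ hp).pdy hΩ l).mul (berw hΩ hp l k m))).mul (y hΩ m)))

end IsGivenBy

end Coordinates

section Spray

open Set Topology CoordAlg

variable {n : ℕ}

theorem CoordAlg.Y_sum_X_mul_y {A : Type*} [CommRing A] [Algebra ℝ A] (S : CoordAlg n A) {F : A}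
    (hF : ∀ i, S.Y i F = 0) (m : Fin n) : S.Y m (∑ j, S.X j F * S.y j) = S.X m F := by
  simp [map_sum, S.Y_y, ← S.X_Y, hF]

theorem CoordAlg.Y_scurv {A : Type*} [CommRing A] [Algebra ℝ A] (S : CoordAlg n A)
    (g : Fin n → A) {L : A} (hL : ∀ i, S.Y i L = 0) (m : Fin n) :
    S.Y m (S.scurv g L) = S.Y m (∑ j, S.conn g j j) - S.X m L := by
  rw [← S.Y_sum_X_mul_y hL m, ← map_sub]
  simp only [scurv, mul_comm]

theorem isOpen_prod_slit {U : Set (Vec n)} (hU : IsOpen U) : IsOpen (U ×ˢ slit n) :=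
  hU.prod isOpen_ne

/-- A smooth function on the base as an element of the algebra of smooth functions. -/
def smoothAlg.ofBase {U : Set (Vec n)} (f : Vec n → ℝ) (hf : ContDiffOn ℝ (⊤ : ℕ∞) f U) :
    smoothAlg (U ×ˢ slit n) :=
  smoothAlg.ofContDiffOn (fun p ↦ f p.1) (hf.comp contDiffOn_fst fun _ hp ↦ hp.1)

theorem isGivenBy_ofBase {U : Set (Vec n)} {f : Vec n → ℝ} (hf : ContDiffOn ℝ (⊤ : ℕ∞) f U) :
    IsGivenBy (smoothAlg.ofBase f hf) fun x _ ↦ f x :=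
  fun _ _ _ ↦ rfl

theorem coordAlg_Y_ofBase {U : Set (Vec n)} (hU : IsOpen U) {f : Vec n → ℝ}
    (hf : ContDiffOn ℝ (⊤ : ℕ∞) f U) (i : Fin n) :
    (coordAlg (isOpen_prod_slit hU)).Y i (smoothAlg.ofBase f hf) = 0 := by
  ext p
  refine ((isGivenBy_ofBase hf).pdy (isOpen_prod_slit hU) i _ _ p.2).trans ?_
  simp [pdy]

theorem IsVolumeForm.contDiffOn_log {U : Set (Vec n)} {σ : Vec n → ℝ} (hσ : IsVolumeForm U σ) :
    ContDiffOn ℝ (⊤ : ℕ∞) (fun x ↦ Real.log (σ x)) U :=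
  hσ.1.log fun x hx ↦ (hσ.2 x hx).ne'

namespace IsSpray

variable {U : Set (Vec n)} {G : Fin n → Vec n → Vec n → ℝ} {σ : Vec n → ℝ}

/-- The coefficients of a spray as elements of the algebra of smooth functions. -/
def coeff (hG : IsSpray U G) (i : Fin n) : smoothAlg (U ×ˢ slit n) :=
  smoothAlg.ofContDiffOn (fun p ↦ G i p.1 p.2) (hG.1 i)

theorem isGivenBy_coeff (hG : IsSpray U G) (i : Fin n) : IsGivenBy (hG.coeff i) (G i) :=
  fun _ _ _ ↦ rfl

theorem sum_mul_pdy (hG : IsSpray U G) (i : Fin n) {x y : Vec n} (hx : x ∈ U) (hy : y ∈ slit n)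
    (hd : DifferentiableAt ℝ (G i x) y) : ∑ j, y j * pdy (G i) j x y = 2 * G i x y := by
  have hlin : ∑ j, y j * pdy (G i) j x y = fderiv ℝ (G i x) y y := by
    have h := congrArg (fderiv ℝ (G i x) y) (Finset.univ_sum_single y)
    rw [map_sum] at h
    refine (Finset.sum_congr rfl fun j _ ↦ ?_).trans h
    have hj : (Pi.single j (y j) : Vec n) = y j • Pi.single j (1 : ℝ) := by
      rw [← Pi.single_smul, smul_eq_mul, mul_one]
    rw [hj, map_smul]
    rfl
  have hc : HasDerivAt (fun c : ℝ ↦ c • y) y 1 := by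
    simpa using (hasDerivAt_id (1 : ℝ)).smul_const y
  have h1 : HasDerivAt (fun c : ℝ ↦ G i x (c • y)) (fderiv ℝ (G i x) y y) 1 :=
    HasFDerivAt.comp_hasDerivAt (1 : ℝ) (by simpa using hd.hasFDerivAt) hc
  have h2 : HasDerivAt (fun c : ℝ ↦ c ^ 2 * G i x y) (2 * G i x y) 1 := by
    simpa using (hasDerivAt_pow 2 (1 : ℝ)).mul_const (G i x y)
  have he : (fun c : ℝ ↦ G i x (c • y)) =ᶠ[𝓝 1] fun c ↦ c ^ 2 * G i x y := by
    filter_upwards [lt_mem_nhds one_pos] with c hc using hG.2 i x hx y hy c hc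
  rw [hlin]
  exact h1.unique (h2.congr_of_eventuallyEq he)

theorem isHom_coeff (hU : IsOpen U) (hG : IsSpray U G) :
    (coordAlg (isOpen_prod_slit hU)).IsHom hG.coeff := fun i ↦ by
  have hΩ := isOpen_prod_slit hU
  ext ⟨⟨x, y⟩, hp⟩
  rw [euler_apply]
  refine (IsGivenBy.sum (fun j ↦ (IsGivenBy.y hΩ j).mul ((hG.isGivenBy_coeff i).pdy hΩ j))
    x y hp).trans (hG.sum_mul_pdy i hp.1 hp.2 ?_)
  exact (((hG.1 i).contDiffAt (hΩ.mem_nhds hp)).differentiableAt (by simp)).comp y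
    (hasFDerivAt_prodMk_right x y).differentiableAt

theorem pdy_scurv_div (hU : IsOpen U) (hG : IsSpray U G) (hσ : IsVolumeForm U σ) {x y : Vec n}
    (hx : x ∈ U) (hy : y ∈ slit n) (m : Fin n) :
    pdy (fun x y ↦ Scurv G σ x y / ((n : ℝ) + 1)) m x y = ((n : ℝ) + 1)⁻¹ *
      (pdy (fun x y ↦ ∑ j, Nc G j j x y) m x y
        - fderiv ℝ (fun x ↦ Real.log (σ x)) x (Pi.single m 1)) := by
  have hΩ := isOpen_prod_slit hU
  have hL := isGivenBy_ofBase hσ.contDiffOn_log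
  rw [← (IsGivenBy.scurv_div hΩ hG.isGivenBy_coeff hL).pdy hΩ m x y ⟨hx, hy⟩,
    Derivation.leibniz, Derivation.map_algebraMap, smul_zero, add_zero, smul_eq_mul,
    Y_scurv _ _ (coordAlg_Y_ofBase hU _)]
  exact (IsGivenBy.const _).mul (((IsGivenBy.sum fun j ↦
    IsGivenBy.conn hΩ hG.isGivenBy_coeff j j).pdy hΩ m).sub (hL.pdx hΩ m)) x y ⟨hx, hy⟩

theorem pdy_scurv_div_add (hU : IsOpen U) (hG : IsSpray U G) (hσ : IsVolumeForm U σ)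
    {f : Vec n → ℝ} (hf : ContDiffOn ℝ (⊤ : ℕ∞) f U) {x y : Vec n} (hx : x ∈ U)
    (hy : y ∈ slit n) (m : Fin n) :
    pdy (fun x y ↦ Scurv G σ x y / ((n : ℝ) + 1) + ∑ j, fderiv ℝ f x (Pi.single j 1) * y j) m x y
      = pdy (fun x y ↦ Scurv G σ x y / ((n : ℝ) + 1)) m x y
        + fderiv ℝ f x (Pi.single m 1) := by
  have hΩ := isOpen_prod_slit hU
  have hS := IsGivenBy.scurv_div hΩ hG.isGivenBy_coeff (isGivenBy_ofBase hσ.contDiffOn_log)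
  have hF := isGivenBy_ofBase hf
  have hsum := hS.add (IsGivenBy.sum (s := .univ) fun j ↦ (hF.pdx hΩ j).mul (IsGivenBy.y hΩ j))
  refine (hsum.pdy hΩ m x y ⟨hx, hy⟩).symm.trans ?_
  rw [map_add, Y_sum_X_mul_y _ (coordAlg_Y_ofBase hU hf)]
  exact (hS.pdy hΩ m).add (hF.pdx hΩ m) x y ⟨hx, hy⟩

/-- The horizontal divergence of the Weyl curvature in terms of the Berwald–Weyl curvature. -/
theorem sum_covD11_weyl (hn : 3 ≤ n) (hU : IsOpen U) (hG : IsSpray U G) (hσ : IsVolumeForm U σ)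
    {x y : Vec n} (hx : x ∈ U) (hy : y ∈ slit n) (k : Fin n) :
    ∑ m, covD11 G (Weyl G) m k m x y = ((n : ℝ) - 2) * (BWeyl G σ k x y
      + ∑ m, Weyl G m k x y * pdy (fun x y ↦ Scurv G σ x y / ((n : ℝ) + 1)) m x y) := by
  have hΩ := isOpen_prod_slit hU
  have hg := hG.isGivenBy_coeff
  have hL := isGivenBy_ofBase hσ.contDiffOn_log
  have hn' : (n : ℝ) - 1 ≠ 0 := by
    have : (3 : ℝ) ≤ n := mod_cast hn
    linarith
  have hW := IsGivenBy.weyl hΩ hg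
  have key := congrArg (fun a ↦ a.1 ⟨(x, y), hx, hy⟩)
    ((isHom_coeff hU hG).divg_weyl hn' (coordAlg_Y_ofBase hU hσ.contDiffOn_log) k)
  refine (IsGivenBy.divg hΩ hg hW k x y ⟨hx, hy⟩).symm.trans (key.trans ?_)
  exact congrArg (((n : ℝ) - 2) * ·) (((IsGivenBy.cotton_proj hΩ hg hL k).add (IsGivenBy.sum
    fun m ↦ (hW m k).mul ((IsGivenBy.scurv_div hΩ hg hL).pdy hΩ m))) x y ⟨hx, hy⟩)

/-- The change of the Berwald–Weyl curvature under a change of volume form. -/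
theorem bweyl_eq_add (hn : 3 ≤ n) (hU : IsOpen U) (hG : IsSpray U G) {τ : Vec n → ℝ}
    (hσ : IsVolumeForm U σ) (hτ : IsVolumeForm U τ) {x y : Vec n} (hx : x ∈ U)
    (hy : y ∈ slit n) (k : Fin n) :
    BWeyl G σ k x y = BWeyl G τ k x y + ∑ m, Weyl G m k x y * (((n : ℝ) + 1)⁻¹ *
      (fderiv ℝ (fun x ↦ Real.log (σ x)) x (Pi.single m 1)
        - fderiv ℝ (fun x ↦ Real.log (τ x)) x (Pi.single m 1))) := by
  have hn' : (n : ℝ) - 2 ≠ 0 := by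
    have : (3 : ℝ) ≤ n := mod_cast hn
    linarith
  have h := mul_left_cancel₀ hn' ((hG.sum_covD11_weyl hn hU hσ hx hy k).symm.trans
    (hG.sum_covD11_weyl hn hU hτ hx hy k))
  rw [← sub_eq_iff_eq_add] at h
  rw [← h, add_sub_assoc, add_assoc, left_eq_add, ← Finset.sum_sub_distrib,
    ← Finset.sum_add_distrib]
  refine Finset.sum_eq_zero fun m _ ↦ ?_
  rw [hG.pdy_scurv_div hU hσ hx hy, hG.pdy_scurv_div hU hτ hx hy]
  ring

end IsSpray

end Spray

/-- Theorem 4.3: for `n ≥ 3` the following are equivalent: (a) `G` is BWeyl-flat;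
(b) for every volume form there is a smooth `f` with `W^o_k = W^m_k f_{x^m}`;
(c) for every volume form there is a smooth `f` with `W^m_{k|m} = (n-2) W^m_k Ξ_{·m}`,
where `Ξ = S/(n+1) + f₀`. -/
theorem stmt_16 {n : ℕ} (hn : 3 ≤ n) (U : Set (Vec n)) (hU : IsOpen U) (hUne : U.Nonempty)
    (G : Fin n → Vec n → Vec n → ℝ) (hG : IsSpray U G) :
    ((∃ σ : Vec n → ℝ, IsVolumeForm U σ ∧
        ∀ x ∈ U, ∀ y ∈ slit n, ∀ k : Fin n, BWeyl G σ k x y = 0) ↔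
      (∀ σ : Vec n → ℝ, IsVolumeForm U σ →
        ∃ f : Vec n → ℝ, ContDiffOn ℝ (⊤ : ℕ∞) f U ∧
          ∀ x ∈ U, ∀ y ∈ slit n, ∀ k : Fin n,
            BWeyl G σ k x y = ∑ m, Weyl G m k x y * fderiv ℝ f x (Pi.single m 1))) ∧
    ((∀ σ : Vec n → ℝ, IsVolumeForm U σ →
        ∃ f : Vec n → ℝ, ContDiffOn ℝ (⊤ : ℕ∞) f U ∧
          ∀ x ∈ U, ∀ y ∈ slit n, ∀ k : Fin n,
            BWeyl G σ k x y = ∑ m, Weyl G m k x y * fderiv ℝ f x (Pi.single m 1)) ↔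
      (∀ σ : Vec n → ℝ, IsVolumeForm U σ →
        ∃ f : Vec n → ℝ, ContDiffOn ℝ (⊤ : ℕ∞) f U ∧
          ∀ x ∈ U, ∀ y ∈ slit n, ∀ k : Fin n,
            ∑ m, covD11 G (Weyl G) m k m x y =
              ((n : ℝ) - 2) * ∑ m, Weyl G m k x y *
                pdy (fun x' y' => Scurv G σ x' y' / ((n : ℝ) + 1)
                  + ∑ m', fderiv ℝ f x' (Pi.single m' 1) * y' m') m x y)) := by
  have hn1 : (n : ℝ) + 1 ≠ 0 := by positivity
  have hn2 : (n : ℝ) - 2 ≠ 0 := by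
    have : (3 : ℝ) ≤ n := mod_cast hn
    linarith
  refine ⟨⟨?_, fun h ↦ ?_⟩, forall₂_congr fun σ hσ ↦ exists_congr fun f ↦
    and_congr_right fun hf ↦ forall₄_congr fun x hx y hy ↦ forall_congr' fun k ↦ ?_⟩
  · rintro ⟨τ, hτ, hflat⟩ σ hσ
    refine ⟨fun x ↦ ((n : ℝ) + 1)⁻¹ * (Real.log (σ x) - Real.log (τ x)),
      contDiffOn_const.mul (hσ.contDiffOn_log.sub hτ.contDiffOn_log), fun x hx y hy k ↦ ?_⟩
    have hd {ρ : Vec n → ℝ} (hρ : IsVolumeForm U ρ) :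
        DifferentiableAt ℝ (fun x ↦ Real.log (ρ x)) x :=
      (hρ.contDiffOn_log.contDiffAt (hU.mem_nhds hx)).differentiableAt (by simp)
    rw [hG.bweyl_eq_add hn hU hσ hτ hx hy, hflat x hx y hy, zero_add,
      fderiv_const_mul ((hd hσ).fun_sub (hd hτ)), fderiv_fun_sub (hd hσ) (hd hτ)]
    rfl
  · have hone : IsVolumeForm U fun _ ↦ 1 := ⟨contDiffOn_const, fun _ _ ↦ one_pos⟩
    obtain ⟨f, hf, hW⟩ := h _ hone
    have hexp : IsVolumeForm U fun x ↦ Real.exp (-((n : ℝ) + 1) * f x) :=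
      ⟨(contDiffOn_const.mul hf).exp, fun _ _ ↦ Real.exp_pos _⟩
    refine ⟨_, hexp, fun x hx y hy k ↦ ?_⟩
    have hd : DifferentiableAt ℝ f x :=
      (hf.contDiffAt (hU.mem_nhds hx)).differentiableAt (by simp)
    rw [hG.bweyl_eq_add hn hU hexp hone hx hy, hW x hx y hy, ← Finset.sum_add_distrib]
    refine Finset.sum_eq_zero fun m _ ↦ ?_
    simp only [Real.log_exp, Real.log_one, fderiv_const_mul hd]
    simp
    field_simp
    ring
  · rw [hG.sum_covD11_weyl hn hU hσ hx hy, mul_right_inj' hn2]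
    simp only [hG.pdy_scurv_div_add hU hσ hf hx hy, mul_add, Finset.sum_add_distrib]
    rw [add_comm, add_right_inj]

end BerwaldWeyl
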